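/- Let φ : 𝓔ₙ×𝓔_{n−1}×⋯×𝓔₁ → B(H₁,H_{n+1}) be a multilinear map which is 𝓓,𝓒-modular, i.e., φ(d y, x_{n−1}, …, x₂, x c) = d φ(y, x_{n−1}, …, x₂, x) c for all x ∈ 𝓔₁, y ∈ 𝓔ₙ, c ∈ 𝓒, d ∈ 𝓓, and suppose the linearization of φ is bounded by K in the Haagerup norm, i.e., for all m₁,…,m_{n−1} ∈ ℕ and all matrices aⁿ ∈ M_{1,m_{n−1}}(𝓔ₙ), a^i ∈ M_{m_i,m_{i−1}}(𝓔_i) (2 ≤ i ≤ n−1), a¹ ∈ M_{m₁,1}(𝓔₁), one has ‖Σ_{i₁,…,i_{n−1}} φ(aⁿ_{1,i_{n−1}}, a^{n−1}_{i_{n−1},i_{n−2}}, …, a¹_{i₁,1})‖ ≤ K ∏_{i=1}^{n} ‖a^i‖. Then φ is completely bounded with complete bound K: for every m ∈ ℕ and all x^i ∈ M_m(𝓔_i), i = 1,…,n, one has ‖φ^{(m)}(xⁿ, x^{n−1}, …, x¹)‖ ≤ K ∏_{i=1}^{n} ‖x^i‖. -/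

import Mathlib

open scoped ComplexInnerProductSpace

noncomputable section

namespace SchurMult

variable {m : ℕ}

/-- Assemble a path of indices from the two endpoints and the middle entries. -/
def glue (X : Fin (m + 2) → Type*) (x1 : X 0)
    (y : ∀ j : Fin m, X j.succ.castSucc) (xn : X (Fin.last (m + 1))) :
    ∀ i : Fin (m + 2), X i :=
  fun i => Fin.cases (motive := fun i => X i) x1
    (fun j => Fin.lastCases (motive := fun j => X j.succ) xn (fun t => y t) j) i

/-- The multiplicities `1, d 0, …, d (m-1), 1`. -/
def dims (d : Fin m → ℕ) : Fin (m + 2) → ℕ :=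
  fun i => Fin.cases (motive := fun _ => ℕ) 1
    (fun j => Fin.lastCases (motive := fun _ => ℕ) 1 (fun t => d t) j) i

/-- The operator norm of a block operator matrix `A : H^b → K^a` between Hilbert space
direct sums, expressed via the associated sesquilinear form. -/
def blockNorm {H K : Type*} [NormedAddCommGroup H] [InnerProductSpace ℂ H]
    [NormedAddCommGroup K] [InnerProductSpace ℂ K] {a b : ℕ}
    (A : Fin a → Fin b → H →L[ℂ] K) : ℝ :=
  sInf {C : ℝ | 0 ≤ C ∧ ∀ (v : Fin b → H) (w : Fin a → K),
    ‖∑ p, ∑ q, (⟪A p q (v q), w p⟫)‖ ≤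
      C * Real.sqrt (∑ q, ‖v q‖ ^ 2) * Real.sqrt (∑ p, ‖w p‖ ^ 2)}

end SchurMult

namespace SchurMult
variable {H K : Type*} [NormedAddCommGroup H] [InnerProductSpace ℂ H]
    [NormedAddCommGroup K] [InnerProductSpace ℂ K]

lemma blockNorm_set_nonempty {a b : ℕ} (A : Fin a → Fin b → H →L[ℂ] K) :
    ∃ C : ℝ, 0 ≤ C ∧ ∀ (v : Fin b → H) (w : Fin a → K),
    ‖∑ p, ∑ q, (⟪A p q (v q), w p⟫)‖ ≤
      C * Real.sqrt (∑ q, ‖v q‖ ^ 2) * Real.sqrt (∑ p, ‖w p‖ ^ 2) := by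
  refine ⟨∑ p, ∑ q, ‖A p q‖, by positivity, fun v w => ?_⟩
  rw [Finset.sum_mul, Finset.sum_mul]
  refine norm_sum_le_of_le _ fun p _ => ?_
  rw [Finset.sum_mul, Finset.sum_mul]
  refine norm_sum_le_of_le _ fun q _ => ?_
  refine (norm_inner_le_norm _ _).trans ?_
  have h1 : ‖v q‖ ≤ Real.sqrt (∑ q, ‖v q‖ ^ 2) :=
    Real.le_sqrt_of_sq_le (Finset.single_le_sum (f := fun q => ‖v q‖ ^ 2) (fun _ _ => by positivity) (Finset.mem_univ q))
  have h2 : ‖w p‖ ≤ Real.sqrt (∑ q, ‖w q‖ ^ 2) :=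
    Real.le_sqrt_of_sq_le (Finset.single_le_sum (f := fun q => ‖w q‖ ^ 2) (fun _ _ => by positivity) (Finset.mem_univ p))
  have h3 := (A p q).le_opNorm (v q)
  gcongr
  exact h3.trans (by gcongr)

lemma blockNorm_le {a b : ℕ} (A : Fin a → Fin b → H →L[ℂ] K) {C : ℝ} (hC : 0 ≤ C)
    (h : ∀ (v : Fin b → H) (w : Fin a → K),
    ‖∑ p, ∑ q, (⟪A p q (v q), w p⟫)‖ ≤
      C * Real.sqrt (∑ q, ‖v q‖ ^ 2) * Real.sqrt (∑ p, ‖w p‖ ^ 2)) : blockNorm A ≤ C :=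
  csInf_le ⟨0, fun _ h => h.1⟩ ⟨hC, h⟩

lemma blockNorm_nonneg {a b : ℕ} (A : Fin a → Fin b → H →L[ℂ] K) : 0 ≤ blockNorm A :=
  Real.sInf_nonneg fun _ h => h.1

lemma blockNorm_spec {a b : ℕ} (A : Fin a → Fin b → H →L[ℂ] K) (v : Fin b → H) (w : Fin a → K) :
    ‖∑ p, ∑ q, (⟪A p q (v q), w p⟫)‖ ≤
      blockNorm A * Real.sqrt (∑ q, ‖v q‖ ^ 2) * Real.sqrt (∑ p, ‖w p‖ ^ 2) := by
  rw [mul_assoc]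
  set s := Real.sqrt (∑ q, ‖v q‖ ^ 2) * Real.sqrt (∑ p, ‖w p‖ ^ 2) with hs
  have hs0 : 0 ≤ s := by positivity
  obtain ⟨C0, hC0⟩ := blockNorm_set_nonempty A
  rcases hs0.eq_or_lt with h | h
  · have := hC0.2 v w
    rw [mul_assoc, ← hs, ← h] at this
    rw [← h]; simpa using this
  · rw [← div_le_iff₀ h]
    refine le_csInf ⟨C0, hC0⟩ fun C hC => ?_
    rw [div_le_iff₀ h, hs, ← mul_assoc]
    exact hC.2 v w

lemma blockNorm_pos {a b : ℕ} (A : Fin a → Fin b → H →L[ℂ] K) (p : Fin a) (q : Fin b)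
    (h : A p q ≠ 0) : 0 < blockNorm A := by
  refine lt_of_le_of_ne (blockNorm_nonneg A) fun h0 => h ?_
  ext v
  have := blockNorm_spec A (Pi.single q v) (Pi.single p (A p q v))
  rw [← h0, Finset.sum_eq_single p, Finset.sum_eq_single q] at this
  · simpa using this
  · intro q' _ hq; simp [hq]
  · simp
  · intro p' _ hp; simp [hp]
  · simp

lemma blockNorm_zero_le {a b : ℕ} :
    blockNorm (fun (_ : Fin a) (_ : Fin b) => (0 : H →L[ℂ] K)) ≤ 0 :=
  blockNorm_le _ le_rfl fun v w => by simp

lemma blockNorm_submatrix {a b a' b' : ℕ} (A : Fin a → Fin b → H →L[ℂ] K)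
    (e : Fin a' → Fin a) (f : Fin b' → Fin b) (he : e.Injective) (hf : f.Injective) :
    blockNorm (fun p q => A (e p) (f q)) ≤ blockNorm A := by
  refine blockNorm_le _ (blockNorm_nonneg A) fun v w => ?_
  have key := blockNorm_spec A (Function.extend f v 0) (Function.extend e w 0)
  have h1 : ∑ q, ‖v q‖ ^ 2 = ∑ q, ‖Function.extend f v 0 q‖ ^ 2 := by
    refine Fintype.sum_of_injective f hf _ _ ?_ ?_
    · intro i hi
      rw [Function.extend_apply' _ _ _ (by simpa using hi)]; simp
    · intro i; rw [hf.extend_apply]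
  have h2 : ∑ q, ‖w q‖ ^ 2 = ∑ q, ‖Function.extend e w 0 q‖ ^ 2 := by
    refine Fintype.sum_of_injective e he _ _ ?_ ?_
    · intro i hi
      rw [Function.extend_apply' _ _ _ (by simpa using hi)]; simp
    · intro i; rw [he.extend_apply]
  have h3 : ∑ p, ∑ q, (⟪A (e p) (f q) (v q), w p⟫)
      = ∑ p, ∑ q, (⟪A p q (Function.extend f v 0 q), Function.extend e w 0 p⟫) := by
    refine Fintype.sum_of_injective e he _ _ ?_ ?_
    · intro i hi
      rw [Function.extend_apply' _ _ _ (by simpa using hi)]; simp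
    · intro i
      rw [he.extend_apply]
      refine Fintype.sum_of_injective f hf _ _ ?_ ?_
      · intro j hj
        rw [Function.extend_apply' _ _ _ (by simpa using hj)]; simp
      · intro j; rw [hf.extend_apply]
  rw [h1, h2, h3]
  exact key

lemma blockNorm_mulRight {a b : ℕ} (A : Fin a → Fin b → H →L[ℂ] K) (q0 : Fin b)
    (c : Fin b → H →L[ℂ] H) (hc : ∀ u, ∑ k, ‖c k u‖ ^ 2 ≤ ‖u‖ ^ 2) :
    blockNorm (fun p q => if q = q0 then ∑ k, A p k ∘L c k else 0) ≤ blockNorm A := by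
  refine blockNorm_le _ (blockNorm_nonneg A) fun v w => ?_
  have key := blockNorm_spec A (fun k => c k (v q0)) w
  have h3 : ∑ p, ∑ q, (⟪(if q = q0 then ∑ k, A p k ∘L c k else 0 : H →L[ℂ] K) (v q), w p⟫)
      = ∑ p, ∑ q, (⟪A p q (c q (v q0)), w p⟫) := by
    refine Finset.sum_congr rfl fun p _ => ?_
    rw [Finset.sum_eq_single q0]
    · simp [sum_inner]
    · intro q _ hq; simp [hq]
    · simp
  rw [h3]
  refine key.trans ?_
  have := blockNorm_nonneg A
  refine mul_le_mul_of_nonneg_right (mul_le_mul_of_nonneg_left (Real.sqrt_le_sqrt ?_) this)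
    (Real.sqrt_nonneg _)
  refine (hc _).trans ?_
  exact Finset.single_le_sum (f := fun q => ‖v q‖ ^ 2) (fun _ _ => by positivity) (Finset.mem_univ q0)

lemma blockNorm_mulLeft [CompleteSpace K] {a b : ℕ} (A : Fin a → Fin b → H →L[ℂ] K) (p0 : Fin a)
    (c : Fin a → K →L[ℂ] K) (hc : ∀ u, ∑ k, ‖c k u‖ ^ 2 ≤ ‖u‖ ^ 2) :
    blockNorm (fun p q => if p = p0 then ∑ k, star (c k) ∘L A k q else 0) ≤ blockNorm A := by
  refine blockNorm_le _ (blockNorm_nonneg A) fun v w => ?_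
  have key := blockNorm_spec A v (fun k => c k (w p0))
  have h3 : ∑ p, ∑ q, (⟪(if p = p0 then ∑ k, star (c k) ∘L A k q else 0 : H →L[ℂ] K) (v q), w p⟫)
      = ∑ p, ∑ q, (⟪A p q (v q), c p (w p0)⟫) := by
    rw [Finset.sum_eq_single p0]
    · rw [Finset.sum_comm]
      simp [sum_inner, ContinuousLinearMap.star_eq_adjoint,
        ContinuousLinearMap.adjoint_inner_left]
    · intro q _ hq; simp [hq]
    · simp
  rw [h3]
  refine key.trans ?_
  have := blockNorm_nonneg A
  refine mul_le_mul_of_nonneg_left (Real.sqrt_le_sqrt ?_)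
    (mul_nonneg this (Real.sqrt_nonneg _))
  refine (hc _).trans ?_
  exact Finset.single_le_sum (f := fun q => ‖w q‖ ^ 2) (fun _ _ => by positivity) (Finset.mem_univ p0)

lemma exists_sqrt_inv [CompleteSpace H] (𝓒 : StarSubalgebra ℂ (H →L[ℂ] H))
    (hcl : IsClosed (𝓒 : Set (H →L[ℂ] H))) (a : H →L[ℂ] H) (hasa : IsSelfAdjoint a)
    (hmem : a ∈ 𝓒) (ε : ℝ) (hε : 0 < ε) (hspec : ∀ x ∈ spectrum ℝ a, ε ≤ x) :
    ∃ r b : H →L[ℂ] H, b ∈ 𝓒 ∧ IsSelfAdjoint r ∧ r * r = a ∧ b * r = 1 ∧ r * b = 1 := by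
  have hcs : ContinuousOn Real.sqrt (spectrum ℝ a) := Real.continuous_sqrt.continuousOn
  have hcont : ContinuousOn (fun x : ℝ => (Real.sqrt x)⁻¹) (spectrum ℝ a) := by
    refine ContinuousOn.inv₀ hcs fun x hx => ?_
    exact (Real.sqrt_pos.2 (hε.trans_le (hspec x hx))).ne'
  refine ⟨cfc Real.sqrt a, cfc (fun x : ℝ => (Real.sqrt x)⁻¹) a, cfc_mem (hs := hcl) _ hmem,
    cfc_predicate _ _, ?_, ?_, ?_⟩
  · rw [← cfc_mul Real.sqrt Real.sqrt a hcs hcs]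
    conv_rhs => rw [← cfc_id ℝ a hasa]
    refine cfc_congr fun x hx => ?_
    exact Real.mul_self_sqrt (hε.le.trans (hspec x hx))
  · rw [← cfc_mul _ _ a hcont hcs, ← cfc_one ℝ a hasa]
    refine cfc_congr fun x hx => ?_
    exact inv_mul_cancel₀ (Real.sqrt_pos.2 (hε.trans_le (hspec x hx))).ne'
  · rw [← cfc_mul _ _ a hcs hcont, ← cfc_one ℝ a hasa]
    refine cfc_congr fun x hx => ?_
    exact mul_inv_cancel₀ (Real.sqrt_pos.2 (hε.trans_le (hspec x hx))).ne'

lemma factor_exact [CompleteSpace H] (𝓒 : StarSubalgebra ℂ (H →L[ℂ] H))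
    (hcl : IsClosed (𝓒 : Set (H →L[ℂ] H))) {m : ℕ} (c : Fin m → H →L[ℂ] H)
    (hc : ∀ q, c q ∈ 𝓒) (ξ : H) (ε : ℝ) (hε : 0 < ε) :
    ∃ (c' : Fin m → H →L[ℂ] H) (ξ' : H), (∀ q, c' q ∈ 𝓒) ∧ (∀ q, c' q ξ' = c q ξ) ∧
      (∀ u, ∑ k, ‖c' k u‖ ^ 2 ≤ ‖u‖ ^ 2) ∧ ‖ξ'‖ ^ 2 = ∑ k, ‖c k ξ‖ ^ 2 + ε * ‖ξ‖ ^ 2 := by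
  set s : H →L[ℂ] H := ∑ k, star (c k) * c k with hs
  set a : H →L[ℂ] H := s + algebraMap ℝ _ ε with ha
  have hs0 : 0 ≤ s := Finset.sum_nonneg fun k _ => star_mul_self_nonneg _
  have hle : algebraMap ℝ _ ε ≤ a := by rw [ha]; exact le_add_of_nonneg_left hs0
  have hasa : IsSelfAdjoint a := by
    refine (IsSelfAdjoint.of_nonneg hs0).add ?_
    exact (IsSelfAdjoint.all ε).algebraMap _
  have hspec : ∀ x ∈ spectrum ℝ a, ε ≤ x := (algebraMap_le_iff_le_spectrum hasa).1 hle
  have hmem : a ∈ 𝓒 := by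
    refine add_mem (sum_mem fun k _ => mul_mem (star_mem (hc k)) (hc k)) ?_
    have : (algebraMap ℝ (H →L[ℂ] H) ε) = algebraMap ℂ (H →L[ℂ] H) (ε : ℂ) := by
      ext; simp [Algebra.algebraMap_eq_smul_one]
    rw [this]
    exact 𝓒.algebraMap_mem _
  obtain ⟨r, b, hbm, hrsa, hrr, hbr, hrb⟩ := exists_sqrt_inv 𝓒 hcl a hasa hmem ε hε hspec
  -- norm identity
  have hnorm : ∀ u, ‖r u‖ ^ 2 = ∑ k, ‖c k u‖ ^ 2 + ε * ‖u‖ ^ 2 := by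
    intro u
    have h1 : (⟪a u, u⟫) = ((‖r u‖ ^ 2 : ℝ) : ℂ) := by
      rw [← hrr, mul_apply_eq_comp, ← ContinuousLinearMap.adjoint_inner_right,
        ← ContinuousLinearMap.star_eq_adjoint, hrsa.star_eq, inner_self_eq_norm_sq_to_K]
      norm_cast
    have h2 : (⟪a u, u⟫) = ((∑ k, ‖c k u‖ ^ 2 + ε * ‖u‖ ^ 2 : ℝ) : ℂ) := by
      rw [ha, hs]
      simp only [add_apply, sum_apply, inner_add_left,
        sum_inner, mul_apply_eq_comp, ContinuousLinearMap.star_eq_adjoint,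
        ContinuousLinearMap.adjoint_inner_left, inner_self_eq_norm_sq_to_K,
        Algebra.algebraMap_eq_smul_one, smul_apply,
        one_apply_eq_self, inner_smul_left_eq_smul]
      push_cast
      simp
    exact_mod_cast h1.symm.trans h2
  refine ⟨fun q => c q * b, r ξ, fun q => mul_mem (hc q) hbm, fun q => ?_, fun u => ?_, hnorm ξ⟩
  · rw [← mul_apply_eq_comp, mul_assoc, hbr, mul_one]
  · have := hnorm (b u)
    rw [← mul_apply_eq_comp, hrb, one_apply_eq_self] at this
    simp only [mul_apply_eq_comp]
    rw [this]
    have : 0 ≤ ε * ‖b u‖ ^ 2 := by positivity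
    linarith

lemma factor_approx [CompleteSpace H] (𝓒 : StarSubalgebra ℂ (H →L[ℂ] H))
    (hcl : IsClosed (𝓒 : Set (H →L[ℂ] H)))
    (hcyc : ∃ v : H, Dense ((fun c : H →L[ℂ] H => c v) '' 𝓒)) {m : ℕ} (v : Fin m → H) :
    ∃ (c : ℕ → Fin m → H →L[ℂ] H) (ξ : ℕ → H), (∀ N q, c N q ∈ 𝓒) ∧
      (∀ N u, ∑ k, ‖c N k u‖ ^ 2 ≤ ‖u‖ ^ 2) ∧
      (∀ q, Filter.Tendsto (fun N => c N q (ξ N)) Filter.atTop (nhds (v q))) ∧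
      Filter.Tendsto (fun N => ‖ξ N‖) Filter.atTop (nhds (Real.sqrt (∑ q, ‖v q‖ ^ 2))) := by
  obtain ⟨ξ0, hd⟩ := hcyc
  have h1 : ∀ q, ∃ f : ℕ → H, (∀ N, f N ∈ ((fun c : H →L[ℂ] H => c ξ0) '' 𝓒)) ∧
      Filter.Tendsto f Filter.atTop (nhds (v q)) := fun q =>
    mem_closure_iff_seq_limit.1 (hd (v q))
  choose f hf hft using h1
  choose c0 hc0 hc0f using hf
  have h2 : ∀ N : ℕ, _ := fun N => factor_exact 𝓒 hcl (fun q => c0 q N) (fun q => hc0 q N) ξ0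
    (1 / ((N : ℝ) + 1)) (by positivity)
  choose c ξ hm hv hcon hn using h2
  refine ⟨c, ξ, hm, hcon, fun q => ?_, ?_⟩
  · simp_rw [hv]
    have : (fun N => c0 q N ξ0) = f q := funext fun N => hc0f q N
    rw [this]; exact hft q
  · have e : (fun N => ‖ξ N‖) = fun N : ℕ => Real.sqrt (∑ q, ‖f q N‖ ^ 2 + 1 / ((N : ℝ) + 1) * ‖ξ0‖ ^ 2) := by
      funext N
      rw [← Real.sqrt_sq (norm_nonneg (ξ N)), hn]
      congr 3
      funext q
      rw [← hc0f q N]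
    rw [e]
    refine (Real.continuous_sqrt.tendsto _).comp ?_
    have := (tendsto_finsetSum (Finset.univ : Finset (Fin m)) fun q _ => ((hft q).norm.pow 2)).add
      ((tendsto_one_div_add_atTop_nhds_zero_nat (𝕜 := ℝ)).mul_const (‖ξ0‖ ^ 2))
    simpa using this

lemma sum_comp_helper {ι : Type*} [Fintype ι] (f : ι → H →L[ℂ] K) (c : H →L[ℂ] H) :
    ∑ i, f i ∘L c = (∑ i, f i) ∘L c := by
  ext u
  simp

lemma comp_sum_helper {ι : Type*} [Fintype ι] (f : ι → H →L[ℂ] K) (c : K →L[ℂ] K) :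
    ∑ i, c ∘L f i = c ∘L (∑ i, f i) := by
  ext u
  simp

lemma blockNorm_le_of_cyclic [CompleteSpace H] [CompleteSpace K]
    (𝓒 : StarSubalgebra ℂ (H →L[ℂ] H)) (hcl : IsClosed (𝓒 : Set (H →L[ℂ] H)))
    (hcyc : ∃ v : H, Dense ((fun c : H →L[ℂ] H => c v) '' 𝓒))
    (𝓓 : StarSubalgebra ℂ (K →L[ℂ] K)) (hdl : IsClosed (𝓓 : Set (K →L[ℂ] K)))
    (hdyc : ∃ v : K, Dense ((fun c : K →L[ℂ] K => c v) '' 𝓓)) {m : ℕ}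
    (T : Fin m → Fin m → H →L[ℂ] K) (M : ℝ) (hM : 0 ≤ M)
    (h : ∀ (c : Fin m → H →L[ℂ] H) (d : Fin m → K →L[ℂ] K), (∀ q, c q ∈ 𝓒) → (∀ q, d q ∈ 𝓓) →
      (∀ u, ∑ k, ‖c k u‖ ^ 2 ≤ ‖u‖ ^ 2) → (∀ u, ∑ k, ‖d k u‖ ^ 2 ≤ ‖u‖ ^ 2) →
      ‖∑ p, star (d p) ∘L (∑ q, T p q ∘L c q)‖ ≤ M) :
    blockNorm T ≤ M := by
  refine blockNorm_le _ hM fun v w => ?_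
  obtain ⟨c, ξ, hc, hcc, hcv, hξ⟩ := factor_approx 𝓒 hcl hcyc v
  obtain ⟨d, η, hd, hdd, hdw, hη⟩ := factor_approx 𝓓 hdl hdyc w
  have h1 : Filter.Tendsto
      (fun N => ‖∑ p, ∑ q, (⟪T p q (c N q (ξ N)), d N p (η N)⟫)‖) Filter.atTop
      (nhds ‖∑ p, ∑ q, (⟪T p q (v q), w p⟫)‖) := by
    refine Filter.Tendsto.norm ?_
    refine tendsto_finsetSum _ fun p _ => tendsto_finsetSum _ fun q _ => ?_
    exact (((T p q).continuous.tendsto _).comp (hcv q)).inner (hdw p)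
  have h2 := (hξ.const_mul M).mul hη
  refine le_of_tendsto_of_tendsto' h1 h2 fun N => ?_
  have e : ∑ p, ∑ q, (⟪T p q (c N q (ξ N)), d N p (η N)⟫)
      = ⟪(∑ p, star (d N p) ∘L (∑ q, T p q ∘L c N q)) (ξ N), η N⟫ := by
    simp [sum_inner, ContinuousLinearMap.star_eq_adjoint, ContinuousLinearMap.adjoint_inner_left]
  rw [e]
  refine (norm_inner_le_norm _ _).trans ?_
  refine mul_le_mul_of_nonneg_right ?_ (norm_nonneg _)
  exact ContinuousLinearMap.le_of_opNorm_le _ (h _ _ (hc N) (hd N) (hcc N) (hdd N)) _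

lemma glue_zero {n : ℕ} (X : Fin (n + 2) → Type*) (a y b) : glue X a y b 0 = a := rfl

lemma glue_succ_indep {n : ℕ} (X : Fin (n + 2) → Type*) (a a' y b) (i : Fin (n + 1)) :
    glue X a y b i.succ = glue X a' y b i.succ := rfl

lemma glue_last {n : ℕ} (X : Fin (n + 2) → Type*) (a y b) :
    glue X a y b (Fin.last (n + 1)) = b := by
  change Fin.lastCases (motive := fun j => X j.succ) b (fun t => y t) (Fin.last n) = b
  simp

lemma glue_mid {n : ℕ} (X : Fin (n + 2) → Type*) (a y b) (t : Fin n) :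
    glue X a y b t.succ.castSucc = y t := by
  change Fin.lastCases (motive := fun j => X j.succ) b (fun t => y t) (Fin.castSucc t) = y t
  simp

lemma path_cases {n : ℕ} {P : Fin (n + 2) → Prop} (h0 : P 0)
    (hm : ∀ t : Fin n, P t.succ.castSucc) (hl : P (Fin.last (n + 1))) : ∀ i, P i := by
  intro i
  refine Fin.cases h0 (fun j => ?_) i
  refine Fin.lastCases hl (fun t => hm t) j

lemma glue_castSucc_indep {n : ℕ} (X : Fin (n + 2) → Type*) (a y b b') (i : Fin (n + 1)) :
    glue X a y b i.castSucc = glue X a y b' i.castSucc := by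
  refine Fin.cases rfl (fun t => ?_) i
  rw [glue_mid, glue_mid]

lemma dims_zero {n : ℕ} (r : Fin n → ℕ) : dims r 0 = 1 := rfl
lemma dims_last {n : ℕ} (r : Fin n → ℕ) : dims r (Fin.last (n + 1)) = 1 :=
  glue_last (fun _ => ℕ) 1 r 1
lemma dims_mid {n : ℕ} (r : Fin n → ℕ) (t : Fin n) : dims r t.succ.castSucc = r t :=
  glue_mid (fun _ => ℕ) 1 r 1 t

/-- Evaluation of padded indices. -/
def ev {n : ℕ} {md : ℕ} (q p : Fin md) (t : Fin (n + 2)) :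
    Fin (dims (fun _ : Fin n => md) t) → Fin md :=
  glue (fun t => Fin (dims (fun _ : Fin n => md) t) → Fin md) (fun _ => q)
    (fun t => Fin.cast (dims_mid _ t)) (fun _ => p) t

lemma ev_injective {n : ℕ} {md : ℕ} (q p : Fin md) (t : Fin (n + 2)) :
    Function.Injective (ev (n := n) q p t) := by
  revert t
  refine path_cases ?_ (fun t => ?_) ?_
  · intro a b _
    have h := dims_zero (fun _ : Fin n => md)
    apply Fin.ext
    omega
  · unfold ev
    rw [glue_mid]
    exact Fin.cast_injective _
  · intro a b _
    have h := dims_last (fun _ : Fin n => md)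
    apply Fin.ext
    omega

/-- Middle paths as full paths. -/
def pathEquiv (n md : ℕ) : (Fin n → Fin md) ≃ (∀ t, Fin (dims (fun _ : Fin n => md) t)) where
  toFun j := glue _ (Fin.cast (dims_zero _).symm 0)
    (fun t => Fin.cast (dims_mid _ t).symm (j t)) (Fin.cast (dims_last _).symm 0)
  invFun j := fun t => Fin.cast (dims_mid _ t) (j t.succ.castSucc)
  left_inv j := by
    funext t
    dsimp only
    rw [glue_mid]
    rfl
  right_inv j := by
    funext t
    revert t
    refine path_cases ?_ (fun t => ?_) ?_
    · have h := dims_zero (fun _ : Fin n => md)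
      apply Fin.ext
      omega
    · dsimp only
      rw [glue_mid]; rfl
    · have h := dims_last (fun _ : Fin n => md)
      apply Fin.ext
      omega

lemma ev_pathEquiv {n md : ℕ} (q p : Fin md) (j : Fin n → Fin md) (t : Fin (n + 2)) :
    ev q p t (pathEquiv n md j t) = glue (fun _ => Fin md) q j p t := by
  revert t
  refine path_cases rfl (fun t => ?_) ?_
  · rw [glue_mid]
    unfold ev pathEquiv
    simp only [Equiv.coe_fn_mk]
    rw [glue_mid, glue_mid]
    rfl
  · rw [glue_last]
    unfold ev
    rw [glue_last]

section main
variable {n : ℕ}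
    {H : Fin (n + 2) → Type*}
    [∀ i, NormedAddCommGroup (H i)] [∀ i, InnerProductSpace ℂ (H i)]
    {E : ∀ i : Fin (n + 1), Submodule ℂ (H i.castSucc →L[ℂ] H i.succ)}
    (φ : MultilinearMap ℂ (fun i : Fin (n + 1) => E i)
      (H ((0 : Fin (n + 1)).castSucc) →L[ℂ] H ((Fin.last n).succ)))

/-- Entries of the amplification. -/
def amp {md : ℕ} (x : ∀ i : Fin (n + 1), Fin md → Fin md → E i) (p q : Fin md) :
    H ((0 : Fin (n + 1)).castSucc) →L[ℂ] H ((Fin.last n).succ) :=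
  ∑ j : ∀ _ : Fin n, Fin md,
    φ (fun i => x i (glue (fun _ => Fin md) q j p i.succ)
              (glue (fun _ => Fin md) q j p i.castSucc))

lemma amp_entry_bound (K : ℝ) (hK0 : 0 ≤ K)
    (hK : ∀ (r : Fin n → ℕ)
      (A : ∀ i : Fin (n + 1), Fin (dims r i.succ) → Fin (dims r i.castSucc) → E i),
      ‖∑ j : ∀ t : Fin (n + 2), Fin (dims r t),
          φ (fun i => A i (j i.succ) (j i.castSucc))‖ ≤
        K * ∏ i : Fin (n + 1),
          blockNorm (fun p q => (A i p q : H i.castSucc →L[ℂ] H i.succ)))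
    {md : ℕ} (x : ∀ i : Fin (n + 1), Fin md → Fin md → E i) (p q : Fin md) :
    ‖amp φ x p q‖ ≤ K * ∏ i : Fin (n + 1),
          blockNorm (fun p q => (x i p q : H i.castSucc →L[ℂ] H i.succ)) := by
  have h := hK (fun _ => md) (fun i a b => x i (ev q p _ a) (ev q p _ b))
  have e : amp φ x p q = ∑ j : ∀ t : Fin (n + 2), Fin (dims (fun _ : Fin n => md) t),
          φ (fun i => x i (ev q p _ (j i.succ)) (ev q p _ (j i.castSucc))) := by
    unfold amp
    refine Fintype.sum_equiv (pathEquiv n md) _ _ fun j => ?_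
    simp_rw [ev_pathEquiv]
  rw [e]
  refine h.trans ?_
  refine mul_le_mul_of_nonneg_left ?_ hK0
  refine Finset.prod_le_prod (fun i _ => blockNorm_nonneg _) fun i _ => ?_
  exact blockNorm_submatrix (fun p q => (x i p q : H i.castSucc →L[ℂ] H i.succ)) _ _
    (ev_injective q p _) (ev_injective q p _)

lemma amp_right (𝓒 : Set
      (H ((0 : Fin (n + 1)).castSucc) →L[ℂ] H ((0 : Fin (n + 1)).castSucc)))
    (hmodE1 : ∀ x ∈ E 0, ∀ c ∈ 𝓒, x ∘L c ∈ E 0)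
    (hφright : ∀ (x : ∀ i, E i) (c) (_ : c ∈ 𝓒) (x0' : E 0),
      (x0' : H ((0 : Fin (n + 1)).castSucc) →L[ℂ] H ((0 : Fin (n + 1)).succ))
          = (x 0 : _ →L[ℂ] _) ∘L c →
      φ (Function.update x 0 x0') = (φ x) ∘L c)
    {md : ℕ} (x : ∀ i : Fin (n + 1), Fin md → Fin md → E i) (q0 : Fin md)
    (c : Fin md → _) (hc : ∀ k, c k ∈ 𝓒) (p : Fin md) :
    amp φ (Function.update x 0 (fun p q => if q = q0 then
      ∑ k, ⟨(x 0 p k : _ →L[ℂ] _) ∘L c k, hmodE1 _ (x 0 p k).2 _ (hc k)⟩ else 0)) p q0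
      = ∑ k, amp φ x p k ∘L c k := by
  have key : ∀ (j : Fin n → Fin md),
      φ (fun i => (Function.update x 0 (fun p q => if q = q0 then
      ∑ k, ⟨(x 0 p k : _ →L[ℂ] _) ∘L c k, hmodE1 _ (x 0 p k).2 _ (hc k)⟩ else 0)) i
        (glue (fun _ => Fin md) q0 j p i.succ) (glue (fun _ => Fin md) q0 j p i.castSucc))
      = ∑ k, φ (fun i => x i (glue (fun _ => Fin md) k j p i.succ)
              (glue (fun _ => Fin md) k j p i.castSucc)) ∘L c k := by
    intro j
    have e1 : (fun i => (Function.update x 0 (fun p q => if q = q0 then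
      ∑ k, ⟨(x 0 p k : _ →L[ℂ] _) ∘L c k, hmodE1 _ (x 0 p k).2 _ (hc k)⟩ else 0)) i
        (glue (fun _ => Fin md) q0 j p i.succ) (glue (fun _ => Fin md) q0 j p i.castSucc))
      = Function.update (fun i => x i (glue (fun _ => Fin md) q0 j p i.succ)
          (glue (fun _ => Fin md) q0 j p i.castSucc)) 0
          (∑ k, ⟨(x 0 (glue (fun _ => Fin md) q0 j p (Fin.succ 0)) k : _ →L[ℂ] _) ∘L c k,
            hmodE1 _ (x 0 _ k).2 _ (hc k)⟩) := by
      funext i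
      by_cases hi : i = 0
      · subst hi
        rw [Function.update_self, Function.update_self]
        exact if_pos rfl
      · rw [Function.update_of_ne hi, Function.update_of_ne hi]
    rw [e1, MultilinearMap.map_update_sum]
    refine Finset.sum_congr rfl fun k _ => ?_
    rw [← hφright (fun i => x i (glue (fun _ => Fin md) k j p i.succ)
              (glue (fun _ => Fin md) k j p i.castSucc)) (c k) (hc k)
        ⟨(x 0 (glue (fun _ => Fin md) q0 j p (Fin.succ 0)) k : _ →L[ℂ] _) ∘L c k,
            hmodE1 _ (x 0 _ k).2 _ (hc k)⟩ rfl]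
    congr 1
    funext i
    by_cases hi : i = 0
    · subst hi
      rw [Function.update_self, Function.update_self]
    · rw [Function.update_of_ne hi, Function.update_of_ne hi]
      obtain ⟨i', rfl⟩ := Fin.exists_succ_eq.2 hi
      rfl
  unfold amp
  simp_rw [key]
  rw [Finset.sum_comm]
  refine Finset.sum_congr rfl fun k _ => ?_
  exact sum_comp_helper _ _

lemma amp_left (𝓓 : Set
      (H ((Fin.last n).succ) →L[ℂ] H ((Fin.last n).succ)))
    (hmodEn : ∀ y ∈ E (Fin.last n), ∀ d ∈ 𝓓, d ∘L y ∈ E (Fin.last n))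
    (hφleft : ∀ (x : ∀ i, E i) (d) (_ : d ∈ 𝓓) (xn' : E (Fin.last n)),
      (xn' : H ((Fin.last n).castSucc) →L[ℂ] H ((Fin.last n).succ))
          = d ∘L (x (Fin.last n) : _ →L[ℂ] _) →
      φ (Function.update x (Fin.last n) xn') = d ∘L (φ x))
    {md : ℕ} (x : ∀ i : Fin (n + 1), Fin md → Fin md → E i) (p0 : Fin md)
    (d : Fin md → _) (hd : ∀ k, d k ∈ 𝓓) (q : Fin md) :
    amp φ (Function.update x (Fin.last n) (fun p q => if p = p0 then
      ∑ k, ⟨d k ∘L (x (Fin.last n) k q : _ →L[ℂ] _), hmodEn _ (x _ k q).2 _ (hd k)⟩ else 0)) p0 q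
      = ∑ k, d k ∘L amp φ x k q := by
  have key : ∀ (j : Fin n → Fin md),
      φ (fun i => (Function.update x (Fin.last n) (fun p q => if p = p0 then
      ∑ k, ⟨d k ∘L (x (Fin.last n) k q : _ →L[ℂ] _), hmodEn _ (x _ k q).2 _ (hd k)⟩ else 0)) i
        (glue (fun _ => Fin md) q j p0 i.succ) (glue (fun _ => Fin md) q j p0 i.castSucc))
      = ∑ k, d k ∘L φ (fun i => x i (glue (fun _ => Fin md) q j k i.succ)
              (glue (fun _ => Fin md) q j k i.castSucc)) := by
    intro j
    have e1 : (fun i => (Function.update x (Fin.last n) (fun p q => if p = p0 then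
      ∑ k, ⟨d k ∘L (x (Fin.last n) k q : _ →L[ℂ] _), hmodEn _ (x _ k q).2 _ (hd k)⟩ else 0)) i
        (glue (fun _ => Fin md) q j p0 i.succ) (glue (fun _ => Fin md) q j p0 i.castSucc))
      = Function.update (fun i => x i (glue (fun _ => Fin md) q j p0 i.succ)
          (glue (fun _ => Fin md) q j p0 i.castSucc)) (Fin.last n)
          (∑ k, ⟨d k ∘L (x (Fin.last n) k
            (glue (fun _ => Fin md) q j p0 (Fin.last n).castSucc) : _ →L[ℂ] _),
            hmodEn _ (x _ k _).2 _ (hd k)⟩) := by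
      funext i
      by_cases hi : i = Fin.last n
      · subst hi
        rw [Function.update_self, Function.update_self]
        exact if_pos (glue_last _ _ _ _)
      · rw [Function.update_of_ne hi, Function.update_of_ne hi]
    rw [e1, MultilinearMap.map_update_sum]
    refine Finset.sum_congr rfl fun k _ => ?_
    rw [← hφleft (fun i => x i (glue (fun _ => Fin md) q j k i.succ)
              (glue (fun _ => Fin md) q j k i.castSucc)) (d k) (hd k)
        ⟨d k ∘L (x (Fin.last n) k
            (glue (fun _ => Fin md) q j p0 (Fin.last n).castSucc) : _ →L[ℂ] _),
            hmodEn _ (x _ k _).2 _ (hd k)⟩ (by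
          have h1 : glue (fun _ => Fin md) q j k (Fin.last n).succ = k := glue_last _ _ _ _
          dsimp only
          rw [h1, glue_castSucc_indep (fun _ => Fin md) q j k p0])]
    congr 1
    funext i
    by_cases hi : i = Fin.last n
    · subst hi
      rw [Function.update_self, Function.update_self]
    · rw [Function.update_of_ne hi, Function.update_of_ne hi]
      rw [glue_castSucc_indep (fun _ => Fin md) q j k p0]
      obtain ⟨i', rfl⟩ := Fin.exists_castSucc_eq.2 hi
      have hg : glue (fun _ => Fin md) q j k i'.castSucc.succ
          = glue (fun _ => Fin md) q j p0 i'.castSucc.succ :=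
        glue_castSucc_indep (fun _ => Fin md) q j k p0 i'.succ
      rw [hg]
  unfold amp
  simp_rw [key]
  rw [Finset.sum_comm]
  refine Finset.sum_congr rfl fun k _ => ?_
  exact comp_sum_helper _ _

lemma neg_case (K : ℝ) (hK0 : K < 0)
    (hK : ∀ (r : Fin n → ℕ)
      (A : ∀ i : Fin (n + 1), Fin (dims r i.succ) → Fin (dims r i.castSucc) → E i),
      ‖∑ j : ∀ t : Fin (n + 2), Fin (dims r t),
          φ (fun i => A i (j i.succ) (j i.castSucc))‖ ≤
        K * ∏ i : Fin (n + 1),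
          blockNorm (fun p q => (A i p q : H i.castSucc →L[ℂ] H i.succ))) :
    ∃ i, ∀ y : E i, y = 0 := by
  by_contra! hne
  choose y hy using hne
  have h := hK (fun _ => 1) (fun i _ _ => y i)
  have hd : ∀ t : Fin (n + 2), dims (fun _ : Fin n => 1) t = 1 :=
    path_cases rfl (fun t => dims_mid _ t) (dims_last _)
  have hpos : 0 < ∏ i : Fin (n + 1), blockNorm (fun (_ : Fin (dims (fun _ : Fin n => 1) i.succ))
      (_ : Fin (dims (fun _ : Fin n => 1) i.castSucc)) => (y i : H i.castSucc →L[ℂ] H i.succ)) := by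
    refine Finset.prod_pos fun i _ => ?_
    refine blockNorm_pos _ ⟨0, by rw [hd]; exact one_pos⟩ ⟨0, by rw [hd]; exact one_pos⟩ ?_
    simpa using hy i
  have := mul_neg_of_neg_of_pos hK0 hpos
  exact absurd ((norm_nonneg _).trans h) (not_le.2 this)

end main
end SchurMult

section
open SchurMult

/-- A `𝓓,𝓒`-modular multilinear map `φ : 𝓔ₙ×⋯×𝓔₁ → B(H₁,H_{n+1})`
(where `𝓒`, `𝓓` are C*-algebras with cyclic vectors, `𝓔₁` a right `𝓒`-module and `𝓔ₙ`
a left `𝓓`-module) whose linearization is bounded by `K` in the Haagerup norm is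
completely bounded with complete bound `K`.  Here slot `i : Fin (n+1)` of `φ`
corresponds to `𝓔_{i+1}`. -/
theorem modular_haagerup_bounded_is_completely_bounded {n : ℕ}
    (H : Fin (n + 2) → Type*)
    [∀ i, NormedAddCommGroup (H i)] [∀ i, InnerProductSpace ℂ (H i)]
    [∀ i, CompleteSpace (H i)]
    (E : ∀ i : Fin (n + 1), Submodule ℂ (H i.castSucc →L[ℂ] H i.succ))
    (𝓒 : StarSubalgebra ℂ
      (H ((0 : Fin (n + 1)).castSucc) →L[ℂ] H ((0 : Fin (n + 1)).castSucc)))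
    (𝓓 : StarSubalgebra ℂ
      (H ((Fin.last n).succ) →L[ℂ] H ((Fin.last n).succ)))
    (h𝓒closed : IsClosed (𝓒 : Set
      (H ((0 : Fin (n + 1)).castSucc) →L[ℂ] H ((0 : Fin (n + 1)).castSucc))))
    (h𝓓closed : IsClosed (𝓓 : Set
      (H ((Fin.last n).succ) →L[ℂ] H ((Fin.last n).succ))))
    (h𝓒cyclic : ∃ v : H ((0 : Fin (n + 1)).castSucc),
      Dense ((fun c : H ((0 : Fin (n + 1)).castSucc) →L[ℂ] H ((0 : Fin (n + 1)).castSucc)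
        => c v) '' 𝓒))
    (h𝓓cyclic : ∃ w : H ((Fin.last n).succ),
      Dense ((fun dd : H ((Fin.last n).succ) →L[ℂ] H ((Fin.last n).succ) => dd w) '' 𝓓))
    (hmodE1 : ∀ x ∈ E 0, ∀ c ∈ 𝓒, x ∘L c ∈ E 0)
    (hmodEn : ∀ y ∈ E (Fin.last n), ∀ d ∈ 𝓓, d ∘L y ∈ E (Fin.last n))
    (φ : MultilinearMap ℂ (fun i : Fin (n + 1) => E i)
      (H ((0 : Fin (n + 1)).castSucc) →L[ℂ] H ((Fin.last n).succ)))
    (hφright : ∀ (x : ∀ i, E i) (c) (_ : c ∈ 𝓒) (x0' : E 0),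
      (x0' : H ((0 : Fin (n + 1)).castSucc) →L[ℂ] H ((0 : Fin (n + 1)).succ))
          = (x 0 : _ →L[ℂ] _) ∘L c →
      φ (Function.update x 0 x0') = (φ x) ∘L c)
    (hφleft : ∀ (x : ∀ i, E i) (d) (_ : d ∈ 𝓓) (xn' : E (Fin.last n)),
      (xn' : H ((Fin.last n).castSucc) →L[ℂ] H ((Fin.last n).succ))
          = d ∘L (x (Fin.last n) : _ →L[ℂ] _) →
      φ (Function.update x (Fin.last n) xn') = d ∘L (φ x))
    (K : ℝ)
    (hK : ∀ (r : Fin n → ℕ)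
      (A : ∀ i : Fin (n + 1), Fin (dims r i.succ) → Fin (dims r i.castSucc) → E i),
      ‖∑ j : ∀ t : Fin (n + 2), Fin (dims r t),
          φ (fun i => A i (j i.succ) (j i.castSucc))‖ ≤
        K * ∏ i : Fin (n + 1),
          blockNorm (fun p q => (A i p q : H i.castSucc →L[ℂ] H i.succ))) :
    ∀ (md : ℕ) (x : ∀ i : Fin (n + 1), Fin md → Fin md → E i),
      blockNorm (fun p q : Fin md =>
          ∑ j : ∀ t : Fin n, Fin md,
            φ (fun i => x i (glue (fun _ => Fin md) q j p i.succ)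
              (glue (fun _ => Fin md) q j p i.castSucc))) ≤
        K * ∏ i : Fin (n + 1),
          blockNorm (fun p q => (x i p q : H i.castSucc →L[ℂ] H i.succ)) := by
  intro md x
  rcases lt_or_ge K 0 with hK0 | hK0
  · obtain ⟨i, hi⟩ := neg_case φ K hK0 hK
    have h1 : ∀ y : ∀ i, E i, φ y = 0 := fun y => φ.map_coord_zero i (hi _)
    have h2 : blockNorm (fun p q => (x i p q : H i.castSucc →L[ℂ] H i.succ)) = 0 := by
      refine le_antisymm (blockNorm_le _ le_rfl fun v w => ?_) (blockNorm_nonneg _)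
      simp [hi (x i _ _)]
    rw [Finset.prod_eq_zero (Finset.mem_univ i) h2, mul_zero]
    simp only [h1, Finset.sum_const_zero]
    exact blockNorm_zero_le
  have hM : 0 ≤ K * ∏ i : Fin (n + 1),
          blockNorm (fun p q => (x i p q : H i.castSucc →L[ℂ] H i.succ)) :=
    mul_nonneg hK0 (Finset.prod_nonneg fun i _ => blockNorm_nonneg _)
  rcases Nat.eq_zero_or_pos md with rfl | hmd
  · refine blockNorm_le _ hM fun v w => ?_
    simp
  change blockNorm (amp φ x) ≤ _
  let z : Fin md := ⟨0, hmd⟩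
  refine blockNorm_le_of_cyclic 𝓒 h𝓒closed h𝓒cyclic 𝓓 h𝓓closed h𝓓cyclic _ _ hM ?_
  intro c d hc hd hcc hdd
  have hds : ∀ k, star (d k) ∈ 𝓓 := fun k => star_mem (hd k)
  have hR := amp_right φ 𝓒 hmodE1 hφright x z c hc
  set y : ∀ i : Fin (n + 1), Fin md → Fin md → E i :=
    Function.update x 0 (fun p q => if q = z then
      ∑ k, ⟨(x 0 p k : _ →L[ℂ] _) ∘L c k, hmodE1 _ (x 0 p k).2 _ (hc k)⟩ else 0) with hy
  have hL := amp_left φ 𝓓 hmodEn hφleft y z (fun k => star (d k)) hds z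
  simp only [hR] at hL
  rw [← hL]
  refine (amp_entry_bound φ K hK0 hK _ z z).trans ?_
  refine mul_le_mul_of_nonneg_left ?_ hK0
  refine Finset.prod_le_prod (fun i _ => blockNorm_nonneg _) fun i _ => ?_
  have hyx : ∀ i, blockNorm (fun p q => (y i p q : H i.castSucc →L[ℂ] H i.succ)) ≤
      blockNorm (fun p q => (x i p q : H i.castSucc →L[ℂ] H i.succ)) := by
    intro i
    by_cases hi : i = 0
    · subst hi
      rw [hy, Function.update_self]
      refine le_trans (le_of_eq ?_) (blockNorm_mulRight (fun p q => (x 0 p q :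
        H (Fin.castSucc 0) →L[ℂ] H (Fin.succ 0))) z c hcc)
      congr 1
      funext p q
      split_ifs
      · exact AddSubmonoidClass.coe_finsetSum _ _
      · rfl
    · rw [hy, Function.update_of_ne hi]
  refine le_trans ?_ (hyx i)
  by_cases hi : i = Fin.last n
  · subst hi
    rw [Function.update_self]
    refine le_trans (le_of_eq ?_) (blockNorm_mulLeft (fun p q => (y (Fin.last n) p q :
        H (Fin.castSucc (Fin.last n)) →L[ℂ] H (Fin.last n).succ)) z d hdd)
    congr 1
    funext p q
    split_ifs
    · exact AddSubmonoidClass.coe_finsetSum _ _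
    · rfl
  · rw [Function.update_of_ne hi]
end
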